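/- Let a, b, c, d be real with t = a+b+c+d, let n ≥ k ≥ 0 be integers, and let (x,y) be real with x ≠ 1; write u(x,y) = P_{n,k}^{(a,b,c,d)}(x,y). Then: (x(n+a+b+c+d+2) − a − n + k − 1)·u − x(1−x)·∂u/∂x + xy·∂u/∂y = (n−k+1)·P_{n+1,k}^{(a,b,c,d−1)}(x,y); (k/(1−x) − n)·u + x·∂u/∂x − (xy/(1−x))·∂u/∂y = (n−k+a)·P_{n−1,k}^{(a,b,c,d+1)}(x,y); n·u + (1−x)·∂u/∂x − y·∂u/∂y = (n+k+t−a+1)·P_{n−1,k}^{(a+1,b,c,d)}(x,y); and (x(n+a+b+c+d+2) − a)·u − x(1−x)·∂u/∂x + xy·∂u/∂y = (n−k+1)·P_{n+1,k}^{(a−1,b,c,d)}(x,y). -/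

import Mathlib

noncomputable section

/-- Generalized binomial coefficient `C(α, j) = α(α−1)⋯(α−j+1)/j!`. -/
def genBinom (α : ℝ) (j : ℕ) : ℝ :=
  (∏ i ∈ Finset.range j, (α - i)) / (Nat.factorial j)

/-- Jacobi polynomial `P_n^{(a,b)}(x)`; zero for negative `n`. -/
def jacobiP (n : ℤ) (a b : ℝ) (x : ℝ) : ℝ :=
  if n < 0 then 0 else
    ∑ m ∈ Finset.range (n.toNat + 1),
      genBinom ((n : ℝ) + a) (n.toNat - m) * genBinom ((n : ℝ) + b) m *
        ((x - 1) / 2) ^ m * ((x + 1) / 2) ^ (n.toNat - m)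

/-- Four-parameter Koornwinder polynomial `P_{n,k}^{(a,b,c,d)}(x,y)`;
zero whenever `k < 0`, `n < 0`, or `k > n` (covering the conventions
`k = −1`, `n = −1`, `k = n+1`). -/
def koornP (n k : ℤ) (a b c d : ℝ) (x y : ℝ) : ℝ :=
  if n < 0 ∨ k < 0 ∨ n < k then 0 else
    jacobiP (n - k) (2 * (k : ℝ) + b + c + d + 1) a (2 * x - 1) *
      (1 - x) ^ k.toNat * jacobiP k c b (-1 + 2 * y / (1 - x))

theorem genBinom_zero (α : ℝ) : genBinom α 0 = 1 := by simp [genBinom]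

theorem succ_mul_genBinom_succ (α : ℝ) (j : ℕ) :
    ((j : ℝ) + 1) * genBinom α (j + 1) = (α - j) * genBinom α j := by
  have h : (Nat.factorial j : ℝ) ≠ 0 := by positivity
  have h' : (j : ℝ) + 1 ≠ 0 := by positivity
  simp only [genBinom, Finset.prod_range_succ, Nat.factorial_succ]
  push_cast
  field_simp

theorem succ_mul_genBinom_add_one_succ (α : ℝ) (j : ℕ) :
    ((j : ℝ) + 1) * genBinom (α + 1) (j + 1) = (α + 1) * genBinom α j := by
  have h : (Nat.factorial j : ℝ) ≠ 0 := by positivity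
  have h' : (j : ℝ) + 1 ≠ 0 := by positivity
  simp only [genBinom, Finset.prod_range_succ', Nat.factorial_succ]
  push_cast
  simp only [add_sub_add_right_eq_sub, sub_zero]
  field_simp

theorem genBinom_add_one_succ (α : ℝ) (j : ℕ) :
    genBinom (α + 1) (j + 1) = genBinom α (j + 1) + genBinom α j := by
  have h' : (j : ℝ) + 1 ≠ 0 := by positivity
  apply mul_left_cancel₀ h'
  rw [mul_add, succ_mul_genBinom_add_one_succ, succ_mul_genBinom_succ]
  ring

open Finset in
theorem sum_antidiagonal_shift (n : ℕ) (f : ℕ → ℕ → ℝ) (h₀ : ∀ j, f 0 j = 0)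
    (h₁ : ∀ i, f i 0 = 0) :
    ∑ p ∈ antidiagonal n, f (p.1 + 1) p.2 = ∑ p ∈ antidiagonal n, f p.1 (p.2 + 1) := by
  have e₁ := Nat.sum_antidiagonal_succ (n := n) (f := fun p : ℕ × ℕ => f p.1 p.2)
  have e₂ := Nat.sum_antidiagonal_succ' (n := n) (f := fun p : ℕ × ℕ => f p.1 p.2)
  simp only [h₀, h₁, zero_add] at e₁ e₂
  exact e₁.symm.trans e₂

/-- The bivariate homogeneous form whose restriction to `X = (x+1)/2`, `W = (x-1)/2` is the
Jacobi polynomial of degree `n`. -/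
def jacobiForm (n : ℕ) (a b X W : ℝ) : ℝ :=
  ∑ p ∈ Finset.HasAntidiagonal.antidiagonal n,
    genBinom (n + b) p.1 * genBinom (n + a) p.2 * W ^ p.1 * X ^ p.2

/-- The partial derivative of `jacobiForm` in `W`. -/
def jacobiFormDerivW (n : ℕ) (a b X W : ℝ) : ℝ :=
  ∑ p ∈ Finset.HasAntidiagonal.antidiagonal n,
    genBinom (n + b) p.1 * genBinom (n + a) p.2 * (p.1 * W ^ (p.1 - 1)) * X ^ p.2

theorem jacobiForm_swap (n : ℕ) (a b X W : ℝ) :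
    jacobiForm n b a W X = jacobiForm n a b X W := by
  unfold jacobiForm
  rw [← Finset.Nat.sum_antidiagonal_swap]
  refine Finset.sum_congr rfl fun p _ => ?_
  simp only [Prod.fst_swap, Prod.snd_swap]
  ring

theorem jacobiFormDerivW_swap (n : ℕ) (a b X W : ℝ) :
    jacobiFormDerivW n b a W X = ∑ p ∈ Finset.HasAntidiagonal.antidiagonal n,
      genBinom (n + b) p.1 * genBinom (n + a) p.2 * W ^ p.1 * (p.2 * X ^ (p.2 - 1)) := by
  unfold jacobiFormDerivW
  rw [← Finset.Nat.sum_antidiagonal_swap]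
  refine Finset.sum_congr rfl fun p _ => ?_
  simp only [Prod.fst_swap, Prod.snd_swap]
  ring

theorem jacobiP_natCast (n : ℕ) (a b x : ℝ) :
    jacobiP n a b x = jacobiForm n a b ((x + 1) / 2) ((x - 1) / 2) := by
  unfold jacobiP jacobiForm
  rw [if_neg (by simp), Finset.Nat.sum_antidiagonal_eq_sum_range_succ_mk]
  refine Finset.sum_congr (by simp) fun m _ => ?_
  simp only [Int.cast_natCast, Int.toNat_natCast]
  ring

theorem hasDerivAt_jacobiP (n : ℕ) (a b x : ℝ) :
    HasDerivAt (jacobiP n a b)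
      ((jacobiFormDerivW n a b ((x + 1) / 2) ((x - 1) / 2)
        + jacobiFormDerivW n b a ((x - 1) / 2) ((x + 1) / 2)) / 2) x := by
  rw [jacobiFormDerivW_swap n a b, jacobiFormDerivW, ← Finset.sum_add_distrib, Finset.sum_div]
  rw [show jacobiP n a b = fun x => jacobiForm n a b ((x + 1) / 2) ((x - 1) / 2) from
    funext fun x => jacobiP_natCast n a b x]
  unfold jacobiForm
  refine HasDerivAt.fun_sum fun p _ => ?_
  have hW := (((hasDerivAt_id x).sub_const 1).div_const 2).fun_pow p.1
  have hX := (((hasDerivAt_id x).add_const 1).div_const 2).fun_pow p.2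
  have h := (hW.const_mul (genBinom (n + b) p.1 * genBinom (n + a) p.2)).fun_mul hX
  refine h.congr_deriv ?_
  simp only [id]
  ring

theorem mul_jacobiFormDerivW (n : ℕ) (a b X W : ℝ) :
    W * jacobiFormDerivW n a b X W = ∑ p ∈ Finset.HasAntidiagonal.antidiagonal n,
      p.1 * (genBinom (n + b) p.1 * genBinom (n + a) p.2 * W ^ p.1 * X ^ p.2) := by
  unfold jacobiFormDerivW
  rw [Finset.mul_sum]
  refine Finset.sum_congr rfl fun p _ => ?_
  rcases p with ⟨_ | i, j⟩
  · simp
  · simp [pow_succ]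
    ring

theorem mul_jacobiFormDerivW_swap (n : ℕ) (a b X W : ℝ) :
    X * jacobiFormDerivW n b a W X = ∑ p ∈ Finset.HasAntidiagonal.antidiagonal n,
      p.2 * (genBinom (n + b) p.1 * genBinom (n + a) p.2 * W ^ p.1 * X ^ p.2) := by
  rw [mul_jacobiFormDerivW, ← Finset.Nat.sum_antidiagonal_swap]
  refine Finset.sum_congr rfl fun p _ => ?_
  simp only [Prod.fst_swap, Prod.snd_swap]
  ring

/-- Euler's identity for `jacobiForm`. -/
theorem jacobiForm_euler (n : ℕ) (a b X W : ℝ) :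
    W * jacobiFormDerivW n a b X W + X * jacobiFormDerivW n b a W X
      = n * jacobiForm n a b X W := by
  rw [mul_jacobiFormDerivW, mul_jacobiFormDerivW_swap, ← Finset.sum_add_distrib, jacobiForm,
    Finset.mul_sum]
  refine Finset.sum_congr rfl fun p hp => ?_
  rw [← Finset.HasAntidiagonal.mem_antidiagonal.mp hp]
  push_cast
  ring

theorem jacobiFormDerivW_zero (a b X W : ℝ) : jacobiFormDerivW 0 a b X W = 0 := by
  simp [jacobiFormDerivW]

theorem jacobiFormDerivW_succ (n : ℕ) (a b X W : ℝ) :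
    jacobiFormDerivW (n + 1) a b X W = ((n : ℝ) + 1 + b) * jacobiForm n (a + 1) b X W := by
  unfold jacobiFormDerivW jacobiForm
  rw [Finset.Nat.sum_antidiagonal_succ, Finset.mul_sum]
  simp only [Nat.cast_zero, zero_mul, mul_zero, zero_add]
  refine Finset.sum_congr rfl fun p _ => ?_
  have h := succ_mul_genBinom_add_one_succ (n + b) p.1
  push_cast
  rw [show (n : ℝ) + 1 + b = n + b + 1 by ring, show (n : ℝ) + 1 + a = n + (a + 1) by ring]
  linear_combination genBinom (n + (a + 1)) p.2 * W ^ p.1 * X ^ p.2 * h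

theorem succ_mul_jacobiForm_succ (n : ℕ) (a b X W : ℝ) :
    ((n : ℝ) + 1) * jacobiForm (n + 1) a (b - 1) X W
      = (X * (n + a + 1) + b * W) * jacobiForm n a b X W
        + X * W * (jacobiFormDerivW n a b X W + jacobiFormDerivW n b a W X) := by
  have hb : ((n + 1 : ℕ) : ℝ) + (b - 1) = n + b := by push_cast; ring
  have ha : ((n + 1 : ℕ) : ℝ) + a = n + a + 1 := by push_cast; ring
  have euler := jacobiForm_euler (n + 1) a (b - 1) X W
  rw [mul_jacobiFormDerivW, mul_jacobiFormDerivW_swap, Finset.Nat.sum_antidiagonal_succ,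
    Finset.Nat.sum_antidiagonal_succ', hb, ha] at euler
  simp only [Nat.cast_zero, zero_mul, zero_add] at euler
  have shift := sum_antidiagonal_shift n (fun i j => i * genBinom (n + b) i
    * (genBinom (n + a + 1) j - genBinom (n + a) j) * W ^ i * X ^ j) (by simp)
    (by simp [genBinom_zero])
  have hW := mul_jacobiFormDerivW n a b X W
  have hX := mul_jacobiFormDerivW_swap n a b X W
  push_cast at euler shift
  rw [← euler, ← sub_eq_zero]
  rw [← sub_eq_zero] at shift
  rw [show (X * (n + a + 1) + b * W) * jacobiForm n a b X W
      + X * W * (jacobiFormDerivW n a b X W + jacobiFormDerivW n b a W X)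
    = (X * (n + a + 1) + b * W) * jacobiForm n a b X W
      + X * (W * jacobiFormDerivW n a b X W) + W * (X * jacobiFormDerivW n b a W X) by ring,
    hW, hX, ← shift]
  unfold jacobiForm
  simp only [Finset.mul_sum, ← Finset.sum_add_distrib, ← Finset.sum_sub_distrib]
  refine Finset.sum_congr rfl fun p hp => ?_
  have hp' : (n : ℝ) = p.1 + p.2 := by
    rw [← Finset.HasAntidiagonal.mem_antidiagonal.mp hp]; push_cast; ring
  have h₁ := succ_mul_genBinom_succ (n + b) p.1
  have h₂ := succ_mul_genBinom_add_one_succ (n + a) p.2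
  have h₃ := genBinom_add_one_succ (n + a) p.2
  generalize genBinom (n + b) (p.1 + 1) = B' at *
  generalize genBinom (n + a + 1) (p.2 + 1) = A'' at *
  generalize genBinom (n + a) (p.2 + 1) = A' at *
  generalize genBinom (n + b) p.1 = B at *
  generalize genBinom (n + a) p.2 = A at *
  have hj : (p.2 : ℝ) = n - p.1 := by linarith
  rw [hj] at h₂ ⊢
  linear_combination A * W ^ (p.1 + 1) * X ^ p.2 * h₁
    + B * W ^ p.1 * X ^ (p.2 + 1) * h₂ + p.1 * B * W ^ p.1 * X ^ (p.2 + 1) * h₃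

theorem succ_mul_jacobiForm_succ' (n : ℕ) (a b X W : ℝ) :
    ((n : ℝ) + 1) * jacobiForm (n + 1) (a - 1) b X W
      = (W * (n + b + 1) + a * X) * jacobiForm n a b X W
        + X * W * (jacobiFormDerivW n a b X W + jacobiFormDerivW n b a W X) := by
  have h := succ_mul_jacobiForm_succ n b a W X
  rw [jacobiForm_swap (n + 1) (a - 1) b, jacobiForm_swap n a b] at h
  rw [h]
  ring

theorem koornP_natCast_add (N k : ℕ) (a b c d x y : ℝ) :
    koornP ((k : ℤ) + N) k a b c d x y =
      jacobiForm N (2 * k + b + c + d + 1) a x (x - 1) * (1 - x) ^ k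
        * jacobiP k c b (-1 + 2 * y / (1 - x)) := by
  unfold koornP
  rw [if_neg (by omega), add_sub_cancel_left, jacobiP_natCast]
  simp only [Int.cast_natCast, Int.toNat_natCast]
  ring_nf

theorem koornP_natCast_add_succ_sub_one (N k : ℕ) (a b c d x y : ℝ) :
    koornP ((k : ℤ) + (N + 1 : ℕ) - 1) k a b c d x y =
      jacobiForm N (2 * k + b + c + d + 1) a x (x - 1) * (1 - x) ^ k
        * jacobiP k c b (-1 + 2 * y / (1 - x)) := by
  rw [← koornP_natCast_add]
  congr 1
  push_cast
  ring

/-- The Euler-type first order operator `(1-x)∂ₓ - y∂ᵧ` acts on Koornwinder polynomials through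
their first Jacobi factor only. -/
theorem one_sub_mul_deriv_koornP_sub (N k : ℕ) (a b c d x y : ℝ) (hx : x ≠ 1) :
    (1 - x) * deriv (fun x' => koornP ((k : ℤ) + N) k a b c d x' y) x
        - y * deriv (koornP ((k : ℤ) + N) k a b c d x) y
      = ((1 - x) * (jacobiFormDerivW N (2 * k + b + c + d + 1) a x (x - 1)
            + jacobiFormDerivW N a (2 * k + b + c + d + 1) (x - 1) x)
          - k * jacobiForm N (2 * k + b + c + d + 1) a x (x - 1))
        * ((1 - x) ^ k * jacobiP k c b (-1 + 2 * y / (1 - x))) := by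
  have hx' : 1 - x ≠ 0 := sub_ne_zero.mpr hx.symm
  obtain ⟨R, hR⟩ : ∃ R, HasDerivAt (jacobiP k c b) R (-1 + 2 * y / (1 - x)) :=
    ⟨_, hasDerivAt_jacobiP k c b _⟩
  set α : ℝ := 2 * k + b + c + d + 1 with hα
  have hQ : HasDerivAt (fun x => jacobiForm N α a x (x - 1))
      (jacobiFormDerivW N α a x (x - 1) + jacobiFormDerivW N a α (x - 1) x) x := by
    have h := (hasDerivAt_jacobiP N α a (2 * x - 1)).comp x
      (((hasDerivAt_id x).const_mul 2).sub_const 1)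
    have e₁ : (2 * x - 1 + 1) / 2 = x := by ring
    have e₂ : (2 * x - 1 - 1) / 2 = x - 1 := by ring
    rw [e₁, e₂] at h
    refine (h.congr_deriv (by ring)).congr_of_eventuallyEq (.of_forall fun z => ?_)
    simp only [Function.comp_apply, id, jacobiP_natCast]
    ring_nf
  have h1 : HasDerivAt (fun x : ℝ => 1 - x) (-1) x := (hasDerivAt_id x).const_sub 1
  have hsx : HasDerivAt (fun x => -1 + 2 * y / (1 - x)) (2 * y / (1 - x) ^ 2) x := by
    refine (((hasDerivAt_const x (2 * y)).fun_div h1 hx').const_add (-1)).congr_deriv ?_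
    ring
  have hsy : HasDerivAt (fun y => -1 + 2 * y / (1 - x)) (2 / (1 - x)) y := by
    refine ((((hasDerivAt_id y).const_mul 2).div_const (1 - x)).const_add (-1)).congr_deriv ?_
    ring
  have hdx := ((hQ.fun_mul (h1.fun_pow k)).fun_mul (hR.comp x hsx)).deriv
  have hdy := ((hR.comp y hsy).const_mul
    (jacobiForm N α a x (x - 1) * (1 - x) ^ k)).deriv
  rw [show koornP ((k : ℤ) + N) k a b c d x = _ from
    funext fun y => koornP_natCast_add N k a b c d x y]
  simp only [koornP_natCast_add, ← hα]
  simp only [Function.comp_apply] at hdx hdy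
  rw [hdx, hdy]
  have hk : (1 - x) * (k * (1 - x) ^ (k - 1)) = k * (1 - x) ^ k := by
    cases k with
    | zero => simp
    | succ k => simp [pow_succ]; ring
  generalize jacobiFormDerivW N α a x (x - 1) + jacobiFormDerivW N a α (x - 1) x = Q'
  generalize jacobiForm N α a x (x - 1) = Q
  generalize jacobiP k c b (-1 + 2 * y / (1 - x)) = P
  have hy : (1 - x) * (2 * y / (1 - x) ^ 2) = y * (2 / (1 - x)) := by field_simp
  linear_combination (-(Q * P)) * hk + Q * (1 - x) ^ k * R * hy

theorem koorn_ladder_M40_M50 (a b c d : ℝ) (n k : ℤ) (hk : 0 ≤ k) (hnk : k ≤ n)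
    (x y : ℝ) (hx : x ≠ 1) :
    ((x * ((n : ℝ) + a + b + c + d + 2) - a - (n : ℝ) + (k : ℝ) - 1)
          * koornP n k a b c d x y
        - x * (1 - x) * deriv (fun x' => koornP n k a b c d x' y) x
        + x * y * deriv (koornP n k a b c d x) y
      = ((n : ℝ) - (k : ℝ) + 1) * koornP (n + 1) k a b c (d - 1) x y) ∧
    (((k : ℝ) / (1 - x) - (n : ℝ)) * koornP n k a b c d x y
        + x * deriv (fun x' => koornP n k a b c d x' y) x
        - (x * y / (1 - x)) * deriv (koornP n k a b c d x) y
      = ((n : ℝ) - (k : ℝ) + a) * koornP (n - 1) k a b c (d + 1) x y) ∧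
    ((n : ℝ) * koornP n k a b c d x y
        + (1 - x) * deriv (fun x' => koornP n k a b c d x' y) x
        - y * deriv (koornP n k a b c d x) y
      = ((n : ℝ) + (k : ℝ) + (a + b + c + d) - a + 1)
          * koornP (n - 1) k (a + 1) b c d x y) ∧
    ((x * ((n : ℝ) + a + b + c + d + 2) - a) * koornP n k a b c d x y
        - x * (1 - x) * deriv (fun x' => koornP n k a b c d x' y) x
        + x * y * deriv (koornP n k a b c d x) y
      = ((n : ℝ) - (k : ℝ) + 1) * koornP (n + 1) k (a - 1) b c d x y) := by
  obtain ⟨k, rfl⟩ := Int.eq_ofNat_of_zero_le hk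
  obtain ⟨N, rfl⟩ := Int.le.dest hnk
  have hx' : 1 - x ≠ 0 := sub_ne_zero.mpr hx.symm
  have hE := one_sub_mul_deriv_koornP_sub N k a b c d x y hx
  have hu := koornP_natCast_add N k a b c d x y
  generalize deriv (fun x' => koornP ((k : ℤ) + N) k a b c d x' y) x = ux at *
  generalize deriv (koornP ((k : ℤ) + N) k a b c d x) y = uy at *
  generalize koornP ((k : ℤ) + N) k a b c d x y = u at *
  rw [mul_assoc] at hu
  rw [show (k : ℤ) + N + 1 = k + (N + 1 : ℕ) by push_cast; ring, koornP_natCast_add,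
    koornP_natCast_add]
  set α : ℝ := 2 * k + b + c + d + 1 with hα
  rw [show 2 * (k : ℝ) + b + c + (d - 1) + 1 = α - 1 by rw [hα]; ring]
  have euler := jacobiForm_euler N α a x (x - 1)
  have up := succ_mul_jacobiForm_succ N α a x (x - 1)
  have up' := succ_mul_jacobiForm_succ' N α a x (x - 1)
  have downW : ((N : ℝ) + a) * koornP ((k : ℤ) + N - 1) k a b c (d + 1) x y
      = jacobiFormDerivW N α a x (x - 1)
        * ((1 - x) ^ k * jacobiP k c b (-1 + 2 * y / (1 - x))) := by
    cases N with
    | zero => simp [koornP, jacobiFormDerivW_zero]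
    | succ N =>
      rw [koornP_natCast_add_succ_sub_one, jacobiFormDerivW_succ,
        show 2 * (k : ℝ) + b + c + (d + 1) + 1 = α + 1 by rw [hα]; ring]
      push_cast
      ring
  have downX : ((N : ℝ) + α) * koornP ((k : ℤ) + N - 1) k (a + 1) b c d x y
      = jacobiFormDerivW N a α (x - 1) x
        * ((1 - x) ^ k * jacobiP k c b (-1 + 2 * y / (1 - x))) := by
    cases N with
    | zero => simp [koornP, jacobiFormDerivW_zero]
    | succ N =>
      rw [koornP_natCast_add_succ_sub_one, jacobiFormDerivW_succ, jacobiForm_swap, ← hα]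
      push_cast
      ring
  push_cast
  generalize koornP ((k : ℤ) + N - 1) k a b c (d + 1) x y = v₁ at *
  generalize koornP ((k : ℤ) + N - 1) k (a + 1) b c d x y = v₂ at *
  generalize jacobiFormDerivW N α a x (x - 1) = QW at *
  generalize jacobiFormDerivW N a α (x - 1) x = QX at *
  generalize jacobiForm N α a x (x - 1) = Q at *
  rw [mul_assoc _ ((1 - x) ^ k), mul_assoc _ ((1 - x) ^ k)]
  generalize (1 - x) ^ k * jacobiP k c b (-1 + 2 * y / (1 - x)) = S at *
  have hd : d = α - 2 * k - b - c - 1 := by rw [hα]; ring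
  clear_value α
  subst hd hu
  refine ⟨?_, ?_, ?_, ?_⟩
  · linear_combination (-x) * hE - S * up'
  · have hq : (k : ℝ) / (1 - x) * (Q * S) + x * ux - x * y / (1 - x) * uy
        = (k * (Q * S) + x * ((1 - x) * ux - y * uy)) / (1 - x) := by
      field_simp
      ring
    have hq' : (k * (Q * S) + x * ((1 - x) * ux - y * uy)) / (1 - x)
        = (k * Q + x * (QW + QX)) * S := by
      rw [hE]
      field_simp
      ring
    linear_combination hq + hq' - downW + S * euler
  · linear_combination hE - downX - S * euler
  · linear_combination (-x) * hE - S * up
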